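/- Let G be a connected finite simple graph with n ≥ 2 vertices. Then the zero forcing number and connected domination number satisfy Z(G) = F_1(G) ≤ n - γ_c(G). -/

import Mathlib

open Finset SimpleGraph

/-- One round of the `k`-forcing color change rule: to the currently colored set `C` we add
every vertex `w` having a colored neighbor `v` with at most `k` non-colored neighbors. -/
def kForceStep {V : Type*} [Fintype V] [DecidableEq V] (G : SimpleGraph V)
    [DecidableRel G.Adj] (k : ℕ) (C : Finset V) : Finset V :=
  C ∪ Finset.univ.filter (fun w =>
    ∃ v ∈ C, G.Adj v w ∧ ((G.neighborFinset v) \ C).card ≤ k)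

/-- `S` is a `k`-forcing set: iterating the color change rule starting from `S`
eventually colors all vertices. -/
def IsKForcingSet {V : Type*} [Fintype V] [DecidableEq V] (G : SimpleGraph V)
    [DecidableRel G.Adj] (k : ℕ) (S : Finset V) : Prop :=
  (kForceStep G k)^[Fintype.card V] S = Finset.univ

/-- The `k`-forcing number: the minimum cardinality of a `k`-forcing set. -/
noncomputable def kForcingNumber {V : Type*} [Fintype V] [DecidableEq V] (G : SimpleGraph V)
    [DecidableRel G.Adj] (k : ℕ) : ℕ :=
  sInf {m | ∃ S : Finset V, IsKForcingSet G k S ∧ S.card = m}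

/-- `G` is `k`-connected: it has more than `k` vertices and the removal of any set of fewer
than `k` vertices results in a connected (induced) subgraph. -/
def KConnected {V : Type*} [Fintype V] [DecidableEq V] (G : SimpleGraph V) (k : ℕ) : Prop :=
  k < Fintype.card V ∧
    ∀ A : Finset V, A.card < k → (G.induce ((A : Set V)ᶜ)).Connected

/-- `D` is a connected `k`-dominating set: every vertex not in `D` has at least `k` neighbors
in `D`, and the subgraph induced by `D` is connected. -/
def IsConnKDomSet {V : Type*} [Fintype V] [DecidableEq V] (G : SimpleGraph V)
    [DecidableRel G.Adj] (k : ℕ) (D : Finset V) : Prop :=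
  (∀ v : V, v ∉ D → k ≤ ((G.neighborFinset v) ∩ D).card) ∧
    (G.induce (D : Set V)).Connected

/-- The connected `k`-domination number: the minimum cardinality of a connected
`k`-dominating set. -/
noncomputable def connKDomNumber {V : Type*} [Fintype V] [DecidableEq V] (G : SimpleGraph V)
    [DecidableRel G.Adj] (k : ℕ) : ℕ :=
  sInf {m | ∃ D : Finset V, IsConnKDomSet G k D ∧ D.card = m}

/-- The closed neighborhood of a set of vertices. -/
def closedNeighborFinset {V : Type*} [Fintype V] [DecidableEq V] (G : SimpleGraph V)
    [DecidableRel G.Adj] (D : Finset V) : Finset V :=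
  Finset.univ.filter (fun w => ∃ v ∈ D, v = w ∨ G.Adj v w)

section

variable {V : Type*} [Fintype V] [DecidableEq V] (G : SimpleGraph V) [DecidableRel G.Adj]

lemma subset_kForceStep (k : ℕ) (C : Finset V) : C ⊆ kForceStep G k C :=
  Finset.subset_union_left

/-- A set is `k`-forcing if its only superset closed under the color change rule is the whole
vertex set. -/
lemma isKForcingSet_of_forall_closed (k : ℕ) (S : Finset V)
    (h : ∀ T, S ⊆ T → kForceStep G k T ⊆ T → T = Finset.univ) : IsKForcingSet G k S := by
  have key : ∀ m : ℕ, S ⊆ (kForceStep G k)^[m] S ∧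
      ((kForceStep G k)^[m] S = Finset.univ ∨ m ≤ ((kForceStep G k)^[m] S).card) := by
    intro m
    induction m with
    | zero => simp
    | succ m ih =>
      rw [Function.iterate_succ_apply']
      set T := (kForceStep G k)^[m] S
      have hT := subset_kForceStep G k T
      refine ⟨ih.1.trans hT, ?_⟩
      by_cases hc : kForceStep G k T ⊆ T
      · exact Or.inl (Finset.univ_subset_iff.1 (h T ih.1 hc ▸ hT))
      · rcases ih.2 with hu | hu
        · exact absurd (hu ▸ Finset.subset_univ _) hc
        · exact Or.inr (hu.trans_lt (Finset.card_lt_card ⟨hT, hc⟩))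
  rcases (key (Fintype.card V)).2 with hu | hu
  · exact hu
  · exact (Finset.card_eq_iff_eq_univ _).1 (le_antisymm (Finset.card_le_univ _) hu)

/-- A vertex of a set closed under the zero forcing rule with all but possibly one neighbor in
the set has all its neighbors in the set. -/
lemma neighborFinset_subset_of_closed {T : Finset V} (hT : kForceStep G 1 T ⊆ T) {u w : V}
    (hu : u ∈ T) (h : G.neighborFinset u \ T ⊆ {w}) : G.neighborFinset u ⊆ T := by
  intro x hx
  apply hT
  rw [mem_neighborFinset] at hx
  simp only [kForceStep, Finset.mem_union, Finset.mem_filter, Finset.mem_univ, true_and]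
  exact Or.inr ⟨u, hu, hx, by simpa using Finset.card_le_card h⟩

/-- Some connected dominating set and some zero forcing set have at most `n` vertices
in total. -/
lemma exists_forcing_connDom (hconn : G.Connected) (hn : 2 ≤ Fintype.card V) :
    ∃ D S : Finset V, IsConnKDomSet G 1 D ∧ IsKForcingSet G 1 S ∧
      S.card + D.card ≤ Fintype.card V := by
  classical
  let P : Finset V → Prop := fun D => (G.induce (D : Set V)).Connected ∧ ∃ S : Finset V,
    (∀ T, S ⊆ T → kForceStep G 1 T ⊆ T → closedNeighborFinset G D ⊆ T) ∧
      S.card + D.card ≤ (closedNeighborFinset G D).card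
  have hmem : ∀ (D : Finset V) w, w ∈ closedNeighborFinset G D ↔ ∃ v ∈ D, v = w ∨ G.Adj v w := by
    simp [closedNeighborFinset]
  have hstart : ∃ D, P D := by
    have : Nontrivial V := Fintype.one_lt_card_iff_nontrivial.1 hn
    obtain ⟨v⟩ := hconn.nonempty
    obtain ⟨w, hw⟩ := hconn.preconnected.exists_adj_of_nontrivial v
    have hN : closedNeighborFinset G {v} = insert v (G.neighborFinset v) := by
      ext x; simp [hmem, eq_comm]
    refine ⟨{v}, ?_, insert v ((G.neighborFinset v).erase w), ?_, ?_⟩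
    · rw [Finset.coe_singleton]
      exact Connected.of_subsingleton
    · intro T hST hT
      rw [Finset.insert_subset_iff] at hST
      rw [hN, Finset.insert_subset_iff]
      refine ⟨hST.1, neighborFinset_subset_of_closed G hT (w := w) hST.1 ?_⟩
      intro x hx
      rw [Finset.mem_sdiff] at hx
      by_contra hxw
      exact hx.2 (hST.2 (Finset.mem_erase.2 ⟨by simpa using hxw, hx.1⟩))
    · have hw' : w ∈ G.neighborFinset v := by simpa using hw
      have h1 := Finset.card_erase_add_one hw'
      rw [hN, Finset.card_insert_of_notMem (by simp), Finset.card_insert_of_notMem (by simp),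
        Finset.card_singleton]
      omega
  obtain ⟨D₀, hD₀⟩ := hstart
  obtain ⟨D, hD, hmax⟩ := Finset.exists_max_image (Finset.univ.filter P) Finset.card
    ⟨D₀, by simpa using hD₀⟩
  simp only [Finset.mem_filter, Finset.mem_univ, true_and] at hD hmax
  obtain ⟨hDc, S, hS, hcard⟩ := hD
  have hall : closedNeighborFinset G D = Finset.univ := by
    by_contra hne
    obtain ⟨y, hy⟩ : ∃ y, y ∉ closedNeighborFinset G D := by
      simpa [Finset.eq_univ_iff_forall] using hne
    obtain ⟨⟨x, hx⟩⟩ := hDc.nonempty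
    have hxN : x ∈ closedNeighborFinset G D := (hmem D x).2 ⟨x, hx, Or.inl rfl⟩
    obtain ⟨p⟩ := hconn.preconnected x y
    obtain ⟨⟨⟨u, w⟩, huw⟩, -, hu, hw⟩ :=
      p.exists_boundary_dart (closedNeighborFinset G D : Set V) hxN hy
    simp only [Finset.mem_coe] at hu hw huw
    have huD : u ∉ D := fun h => hw ((hmem D w).2 ⟨u, h, Or.inr huw⟩)
    obtain ⟨v, hvD, hvu⟩ := (hmem D u).1 hu
    have hvu : G.Adj v u := hvu.resolve_left (fun h => huD (h ▸ hvD))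
    set M := G.neighborFinset u \ closedNeighborFinset G D with hM
    have hwM : w ∈ M := by simp [hM, hw, huw]
    have hN : closedNeighborFinset G (insert u D) = closedNeighborFinset G D ∪ M := by
      ext z
      rw [hmem, Finset.exists_mem_insert, ← hmem D z, hM, Finset.mem_union, Finset.mem_sdiff,
        mem_neighborFinset]
      by_cases hz : z ∈ closedNeighborFinset G D
      · simp [hz]
      · have huz : u ≠ z := fun h => hz (h ▸ hu)
        simp [hz, huz]
    have hP : P (insert u D) := by
      refine ⟨?_, S ∪ M.erase w, ?_, ?_⟩
      · rw [Finset.coe_insert, Set.insert_eq]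
        exact connected_induce_union (v := u) (w := v) Preconnected.of_subsingleton
          hDc.preconnected rfl hvD hvu.symm
      · intro T hST hT
        have hNT := hS T (Finset.subset_union_left.trans hST) hT
        have huT : G.neighborFinset u ⊆ T := by
          refine neighborFinset_subset_of_closed G hT (w := w) (hNT hu) ?_
          intro z hz
          rw [Finset.mem_sdiff] at hz
          by_contra hzw
          exact hz.2 (hST (Finset.mem_union_right _ (Finset.mem_erase.2
            ⟨by simpa using hzw, Finset.mem_sdiff.2 ⟨hz.1, fun h => hz.2 (hNT h)⟩⟩)))
        rw [hN]
        exact Finset.union_subset hNT (Finset.sdiff_subset.trans huT)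
      · have hdisj : Disjoint (closedNeighborFinset G D) M := Finset.disjoint_sdiff
        rw [hN, Finset.card_union_of_disjoint hdisj, Finset.card_insert_of_notMem huD]
        have h1 := Finset.card_erase_add_one hwM
        have h2 := Finset.card_union_le S (M.erase w)
        omega
    have := hmax _ hP
    rw [Finset.card_insert_of_notMem huD] at this
    omega
  refine ⟨D, S, ⟨fun v hv => ?_, hDc⟩, isKForcingSet_of_forall_closed G 1 S fun T hST hT => ?_, ?_⟩
  · obtain ⟨x, hxD, hx⟩ := (hmem D v).1 (hall ▸ Finset.mem_univ v)
    have hx : G.Adj x v := hx.resolve_left (fun h => hv (h ▸ hxD))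
    exact Finset.card_pos.2 ⟨x, by simp [hx.symm, hxD]⟩
  · exact Finset.univ_subset_iff.1 (hall ▸ hS T hST hT)
  · simpa [hall] using hcard

end

/-- Corollary: If `G` is connected with `n ≥ 2` vertices, then the zero
forcing number satisfies `Z(G) = F_1(G) ≤ n - γ_c(G)`, where `γ_c` is the connected
domination number (the connected `1`-domination number). -/
theorem zeroForcingNumber_le_card_sub_connDom {V : Type*} [Fintype V] [DecidableEq V]
    (G : SimpleGraph V) [DecidableRel G.Adj]
    (hconn : G.Connected) (hn : 2 ≤ Fintype.card V) :
    kForcingNumber G 1 ≤ Fintype.card V - connKDomNumber G 1 := by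
  obtain ⟨D, S, hD, hS, hcard⟩ := exists_forcing_connDom G hconn hn
  have h1 : kForcingNumber G 1 ≤ S.card := Nat.sInf_le ⟨S, hS, rfl⟩
  have h2 : connKDomNumber G 1 ≤ D.card := Nat.sInf_le ⟨D, hD, rfl⟩
  omega
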